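/- Let p be a prime and t a real number with |t| < p. Define S(t) = ∑_{n odd, n≥1} ζ(n+1) t^{n+1}/p^n, S̄(t) = ∑_{n odd, n≥3} ζ(n) t^{n−1}/p^n and A₁(t) = ∑_{n≥1} 1/(n(1 − t/p + n)). Then S(t) + p·t·S̄(t) = t ( p/(p − t) − (1 − t/p) A₁(t) ). -/

import Mathlib

/-- `S(t) = ∑_{n odd, n ≥ 1} ζ(n+1) t^(n+1) / p^n` (sum over odd `n = 2k+1`). -/
noncomputable def S (p : ℕ) (t : ℝ) : ℝ :=
  ∑' k : ℕ, (riemannZeta (2 * k + 2)).re * t ^ (2 * k + 2) / (p : ℝ) ^ (2 * k + 1)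

/-- `S̄(t) = ∑_{n odd, n ≥ 3} ζ(n) t^(n-1) / p^n` (sum over odd `n = 2k+3`). -/
noncomputable def Sbar (p : ℕ) (t : ℝ) : ℝ :=
  ∑' k : ℕ, (riemannZeta (2 * k + 3)).re * t ^ (2 * k + 2) / (p : ℝ) ^ (2 * k + 3)

/-- `A₁(t) = ∑_{n ≥ 1} 1 / (n (1 - t/p + n))`. -/
noncomputable def A₁ (p : ℕ) (t : ℝ) : ℝ :=
  ∑' n : ℕ, 1 / (((n : ℝ) + 1) * (1 - t / p + ((n : ℝ) + 1)))

theorem hasSum_one_div_succ_pow_riemannZeta_re {k : ℕ} (hk : 1 < k) :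
    HasSum (fun n : ℕ => 1 / ((n : ℝ) + 1) ^ k) (riemannZeta k).re := by
  have hs : Summable (fun n : ℕ => 1 / (n : ℝ) ^ k) := Real.summable_one_div_nat_pow.2 hk
  have hz : riemannZeta k = ((∑' n : ℕ, 1 / (n : ℝ) ^ k : ℝ) : ℂ) := by
    rw [zeta_nat_eq_tsum_of_gt_one hk]
    push_cast
    rfl
  rw [hz, Complex.ofReal_re, hs.tsum_eq_zero_add]
  have h0 : (k : ℕ) ≠ 0 := by omega
  simpa [h0] using ((summable_nat_add_iff 1).2 hs).hasSum

theorem summable_one_div_succ_sq : Summable (fun n : ℕ => 1 / ((n : ℝ) + 1) ^ 2) :=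
  (hasSum_one_div_succ_pow_riemannZeta_re one_lt_two).summable

theorem summable_div_succ_pow {x : ℝ} (hx : |x| < 1) :
    Summable (fun q : ℕ × ℕ => (x / ((q.2 : ℝ) + 1)) ^ (q.1 + 2)) := by
  have hg : Summable (fun q : ℕ × ℕ => |x| ^ q.1 * (1 / ((q.2 : ℝ) + 1) ^ 2)) :=
    (summable_geometric_of_lt_one (abs_nonneg x) hx).mul_of_nonneg summable_one_div_succ_sq
      (fun _ => by positivity) (fun _ => by positivity)
  refine Summable.of_norm_bounded hg fun q => ?_
  have hn : (1 : ℝ) ≤ (q.2 : ℝ) + 1 := by simp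
  rw [Real.norm_eq_abs, abs_pow, abs_div, abs_of_pos (by linarith : (0 : ℝ) < (q.2 : ℝ) + 1),
    pow_add, div_pow _ _ 2]
  gcongr
  · exact div_le_self (abs_nonneg x) hn
  · exact pow_le_one₀ (abs_nonneg x) hx.le

/-- The generating function of the values `ζ(m)`, `m ≥ 2`, as a sum of simple fractions. -/
theorem hasSum_riemannZeta_re_mul_pow {x : ℝ} (hx : |x| < 1) :
    HasSum (fun m : ℕ => (riemannZeta ((m + 2 : ℕ) : ℂ)).re * x ^ (m + 2))
      (∑' n : ℕ, x * (x / (((n : ℝ) + 1) * ((n : ℝ) + 1 - x)))) ∧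
    Summable (fun n : ℕ => x * (x / (((n : ℝ) + 1) * ((n : ℝ) + 1 - x)))) := by
  have hs := summable_div_succ_pow hx
  have hrow : ∀ m : ℕ, HasSum (fun n : ℕ => (x / ((n : ℝ) + 1)) ^ (m + 2))
      ((riemannZeta ((m + 2 : ℕ) : ℂ)).re * x ^ (m + 2)) := fun m => by
    have h := (hasSum_one_div_succ_pow_riemannZeta_re (k := m + 2) (by omega)).mul_right
      (x ^ (m + 2))
    refine h.congr_fun fun n => ?_
    rw [div_pow]; ring
  have hcol : ∀ n : ℕ, HasSum (fun m : ℕ => (x / ((n : ℝ) + 1)) ^ (m + 2))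
      (x * (x / (((n : ℝ) + 1) * ((n : ℝ) + 1 - x)))) := fun n => by
    have hn : (1 : ℝ) ≤ (n : ℝ) + 1 := by simp
    have hy : |x / ((n : ℝ) + 1)| < 1 := by
      rw [abs_div, abs_of_pos (by linarith : (0 : ℝ) < (n : ℝ) + 1)]
      exact (div_le_self (abs_nonneg x) hn).trans_lt hx
    have h := (hasSum_geometric_of_abs_lt_one hy).mul_right ((x / ((n : ℝ) + 1)) ^ 2)
    have hne : (n : ℝ) + 1 - x ≠ 0 := by linarith [(abs_lt.1 hx).2]
    have hne' : (n : ℝ) + 1 ≠ 0 := by positivity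
    have hval : (1 - x / ((n : ℝ) + 1))⁻¹ * (x / ((n : ℝ) + 1)) ^ 2 =
        x * (x / (((n : ℝ) + 1) * ((n : ℝ) + 1 - x))) := by
      rw [show 1 - x / ((n : ℝ) + 1) = ((n : ℝ) + 1 - x) / ((n : ℝ) + 1) by field_simp]
      field_simp
    rw [← hval]
    simpa only [pow_add] using h
  have htot := hs.hasSum.prod_fiberwise hrow
  have hswap := ((Equiv.prodComm ℕ ℕ).hasSum_iff.2 hs.hasSum).prod_fiberwise hcol
  exact ⟨hswap.tsum_eq ▸ htot, hswap.summable⟩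

theorem summable_one_div_succ_mul_one_sub_add {x : ℝ} (hx : x < 1) :
    Summable (fun n : ℕ => 1 / (((n : ℝ) + 1) * (1 - x + ((n : ℝ) + 1)))) := by
  refine Summable.of_nonneg_of_le (fun n => ?_) (fun n => ?_) summable_one_div_succ_sq
  · have : 0 < 1 - x := by linarith
    positivity
  · rw [sq]
    have hn : (n : ℝ) + 1 ≤ 1 - x + ((n : ℝ) + 1) := by linarith
    gcongr

theorem tsum_div_succ_mul_succ_sub {x : ℝ} (hx : x < 1)
    (hs : Summable (fun n : ℕ => x / (((n : ℝ) + 1) * ((n : ℝ) + 1 - x)))) :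
    ∑' n : ℕ, x / (((n : ℝ) + 1) * ((n : ℝ) + 1 - x)) =
      1 / (1 - x) - (1 - x) * ∑' n : ℕ, 1 / (((n : ℝ) + 1) * (1 - x + ((n : ℝ) + 1))) := by
  have hb := (summable_one_div_succ_mul_one_sub_add hx).mul_left (1 - x)
  have hlim : Filter.Tendsto (fun n : ℕ => 1 / (1 - x) - 1 / ((n : ℝ) + (1 - x)))
      Filter.atTop (nhds (1 / (1 - x) - 0)) := by
    refine tendsto_const_nhds.sub ?_
    simp only [one_div]
    exact (Filter.tendsto_atTop_add_const_right _ _ tendsto_natCast_atTop_atTop).inv_tendsto_atTop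
  have hpart : ∀ N : ℕ, ∑ n ∈ Finset.range N, (x / (((n : ℝ) + 1) * ((n : ℝ) + 1 - x)) +
      (1 - x) * (1 / (((n : ℝ) + 1) * (1 - x + ((n : ℝ) + 1))))) =
      1 / (1 - x) - 1 / ((N : ℝ) + (1 - x)) := fun N => by
    induction N with
    | zero => simp
    | succ N ih =>
      rw [Finset.sum_range_succ, ih]
      have hN : (0 : ℝ) ≤ N := N.cast_nonneg
      have h1 : (N : ℝ) + 1 - x ≠ 0 := by linarith
      have h2 : 1 - x + ((N : ℝ) + 1) ≠ 0 := by linarith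
      have h3 : (N : ℝ) + 1 ≠ 0 := by linarith
      have h4 : 1 - x ≠ 0 := by linarith
      push_cast
      rw [show (N : ℝ) + (1 - x) = N + 1 - x by ring,
        show (N : ℝ) + 1 + (1 - x) = 1 - x + (N + 1) by ring]
      field_simp
      ring
  have h := (hs.add hb).hasSum.tendsto_sum_nat
  simp only [hpart] at h
  have := tendsto_nhds_unique h hlim
  rw [hs.tsum_add hb, tsum_mul_left] at this
  linarith

theorem Summable.tsum_even_add_tsum_odd {f : ℕ → ℝ} (hf : Summable f) :
    ∑' k : ℕ, f (2 * k) + ∑' k : ℕ, f (2 * k + 1) = ∑' m : ℕ, f m :=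
  tsum_even_add_odd (hf.comp_injective fun a b h => by simpa using h)
    (hf.comp_injective fun a b h => by simpa using h)

theorem stmt5 (p : ℕ) (hp : p.Prime) (t : ℝ) (ht : |t| < (p : ℝ)) :
    S p t + p * t * Sbar p t = t * ((p : ℝ) / ((p : ℝ) - t) - (1 - t / p) * A₁ p t) := by
  have hp0 : (0 : ℝ) < p := by exact_mod_cast hp.pos
  obtain ⟨x, rfl⟩ : ∃ x : ℝ, t = p * x := ⟨t / p, by field_simp⟩
  have hx : |x| < 1 := by
    rw [abs_mul, abs_of_pos hp0] at ht
    exact lt_of_mul_lt_mul_left (by simpa using ht) hp0.le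
  have hx1 : x < 1 := (abs_lt.1 hx).2
  obtain ⟨hz, hs⟩ := hasSum_riemannZeta_re_mul_pow hx
  have hsplit := hz.summable.tsum_even_add_tsum_odd
  have hS : S p (p * x) =
      p * ∑' k : ℕ, (riemannZeta ((2 * k + 2 : ℕ) : ℂ)).re * x ^ (2 * k + 2) := by
    rw [S, ← tsum_mul_left]
    refine tsum_congr fun k => ?_
    push_cast
    field_simp
    ring
  have hSbar : p * (p * x) * Sbar p (p * x) =
      p * ∑' k : ℕ, (riemannZeta ((2 * k + 1 + 2 : ℕ) : ℂ)).re * x ^ (2 * k + 1 + 2) := by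
    rw [Sbar, ← tsum_mul_left, ← tsum_mul_left]
    refine tsum_congr fun k => ?_
    rw [show ((2 * k + 1 + 2 : ℕ) : ℂ) = 2 * k + 3 by push_cast; ring]
    field_simp
    ring
  rw [hS, hSbar, ← mul_add, hsplit, hz.tsum_eq, tsum_mul_left, A₁,
    show (p : ℝ) * x / p = x by field_simp,
    show (p : ℝ) / (p - p * x) = 1 / (1 - x) by
      rw [show (p : ℝ) - p * x = p * (1 - x) by ring]
      field_simp]
  rcases eq_or_ne x 0 with rfl | hx0
  · simp
  · rw [tsum_div_succ_mul_succ_sub hx1 ((summable_mul_left_iff hx0).1 hs)]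
    ring
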